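/- For all n, k ∈ ℕ one has, as an inequality of rational numbers, s_k(n) ≤ (n − α/2 + β/(α−2))·α^k + (α/2)·(1+α)^k − (β/(α−2))·2^k. -/

import Mathlib

/-- The multiplier picked up by the first `k` iterates of `C` starting at `x`: one factor `α` for
every odd value met. -/
def oddWeight (α : ℕ) (C : ℕ → ℕ) (k x : ℕ) : ℕ :=
  ∏ i ∈ Finset.range k, if C^[i] x % 2 = 0 then 1 else α

theorem oddWeight_succ (α : ℕ) (C : ℕ → ℕ) (k x : ℕ) :
    oddWeight α C (k + 1) x = oddWeight α C k x * if C^[k] x % 2 = 0 then 1 else α :=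
  Finset.prod_range_succ _ _

theorem odd_oddWeight {α : ℕ} (hα : Odd α) (C : ℕ → ℕ) (k x : ℕ) : Odd (oddWeight α C k x) := by
  induction k with
  | zero => simp [oddWeight]
  | succ k ih =>
    rw [oddWeight_succ]
    split_ifs
    · simpa using ih
    · exact ih.mul hα

theorem collatz_add_two_mul {α β : ℕ} {C : ℕ → ℕ}
    (hC : ∀ n : ℕ, C n = if n % 2 = 0 then n / 2 else (α * n + β) / 2) (y z : ℕ) :
    C (y + 2 * z) = C y + (if y % 2 = 0 then 1 else α) * z := by
  rw [hC, hC y, Nat.add_mul_mod_self_left]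
  split_ifs
  · omega
  · rw [show α * (y + 2 * z) + β = α * y + β + 2 * (α * z) by ring]
    omega

theorem collatz_iterate_add_two_pow_mul {α β : ℕ} {C : ℕ → ℕ}
    (hC : ∀ n : ℕ, C n = if n % 2 = 0 then n / 2 else (α * n + β) / 2) (k x q : ℕ) :
    C^[k] (x + 2 ^ k * q) = C^[k] x + oddWeight α C k x * q := by
  induction k generalizing q with
  | zero => simp [oddWeight]
  | succ k ih =>
    rw [Function.iterate_succ_apply', Function.iterate_succ_apply',
      show 2 ^ (k + 1) * q = 2 ^ k * (2 * q) by ring, ih, oddWeight_succ,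
      show oddWeight α C k x * (2 * q) = 2 * (oddWeight α C k x * q) by ring,
      collatz_add_two_mul hC]
    ring

theorem oddWeight_add_two_pow_mul {α β : ℕ} {C : ℕ → ℕ}
    (hC : ∀ n : ℕ, C n = if n % 2 = 0 then n / 2 else (α * n + β) / 2) (k x q : ℕ) :
    oddWeight α C k (x + 2 ^ k * q) = oddWeight α C k x := by
  induction k generalizing q with
  | zero => simp [oddWeight]
  | succ k ih =>
    rw [oddWeight_succ, oddWeight_succ, show 2 ^ (k + 1) * q = 2 ^ k * (2 * q) by ring, ih,
      collatz_iterate_add_two_pow_mul hC,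
      show oddWeight α C k x * (2 * q) = 2 * (oddWeight α C k x * q) by ring,
      Nat.add_mul_mod_self_left]

theorem sum_range_two_pow_succ (f : ℕ → ℕ) (k n : ℕ) :
    ∑ j ∈ Finset.range (2 ^ (k + 1)), f (n + j)
      = ∑ j ∈ Finset.range (2 ^ k), (f (n + j) + f (n + j + 2 ^ k * 1)) := by
  rw [pow_succ, mul_two, Finset.sum_range_add, Finset.sum_add_distrib]
  congr 1
  exact Finset.sum_congr rfl fun j _ => by rw [mul_one, add_assoc, add_comm j]

theorem sum_oddWeight {α β : ℕ} (hα : Odd α) {C : ℕ → ℕ}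
    (hC : ∀ n : ℕ, C n = if n % 2 = 0 then n / 2 else (α * n + β) / 2) (n k : ℕ) :
    ∑ j ∈ Finset.range (2 ^ k), oddWeight α C k (n + j) = (1 + α) ^ k := by
  induction k with
  | zero => simp [oddWeight]
  | succ k ih =>
    rw [sum_range_two_pow_succ, pow_succ, ← ih, Finset.sum_mul]
    refine Finset.sum_congr rfl fun j _ => ?_
    rw [oddWeight_succ, oddWeight_succ, oddWeight_add_two_pow_mul hC,
      collatz_iterate_add_two_pow_mul hC, mul_one]
    have hw := Nat.odd_iff.mp (odd_oddWeight hα C k (n + j))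
    split_ifs
    · omega
    · ring
    · ring
    · omega

theorem two_mul_collatz_add_collatz_le {α β : ℕ} (hα : Odd α) {C : ℕ → ℕ}
    (hC : ∀ n : ℕ, C n = if n % 2 = 0 then n / 2 else (α * n + β) / 2) (y w : ℕ) (hw : Odd w) :
    2 * (C y + C (y + w)) ≤ (1 + α) * y + α * w + β := by
  have hw2 := Nat.odd_iff.mp hw
  have hle : w ≤ α * w := Nat.le_mul_of_pos_left w hα.pos
  rw [hC, hC (y + w), mul_add α, add_mul, one_mul]
  split_ifs <;> omega

theorem two_mul_sum_collatz_iterate_succ_le {α β : ℕ} (hα : Odd α) {C : ℕ → ℕ}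
    (hC : ∀ n : ℕ, C n = if n % 2 = 0 then n / 2 else (α * n + β) / 2) (n k : ℕ) :
    2 * ∑ j ∈ Finset.range (2 ^ (k + 1)), C^[k + 1] (n + j)
      ≤ (1 + α) * ∑ j ∈ Finset.range (2 ^ k), C^[k] (n + j) + α * (1 + α) ^ k + 2 ^ k * β := by
  have hconst : 2 ^ k * β = ∑ _j ∈ Finset.range (2 ^ k), β := by simp
  rw [sum_range_two_pow_succ, ← sum_oddWeight hα hC n k, hconst, Finset.mul_sum, Finset.mul_sum,
    Finset.mul_sum, ← Finset.sum_add_distrib, ← Finset.sum_add_distrib]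
  refine Finset.sum_le_sum fun j _ => ?_
  rw [Function.iterate_succ_apply', Function.iterate_succ_apply',
    collatz_iterate_add_two_pow_mul hC, mul_one]
  exact two_mul_collatz_add_collatz_le hα hC _ _ (odd_oddWeight hα C k _)


/-- upper bound for s_k(n) in ℚ. -/
theorem collatz_sum_upper_bound
    (α β : ℕ) (hα : Odd α) (hα0 : 0 < α) (hβ : Odd β) (hβ0 : 0 < β)
    (hgcd : Nat.gcd α β = 1) (C : ℕ → ℕ)
    (hC : ∀ n : ℕ, C n = if n % 2 = 0 then n / 2 else (α * n + β) / 2)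
    (n k : ℕ) :
    ((∑ j ∈ Finset.range (2 ^ k), C^[k] (n + j) : ℕ) : ℚ)
      ≤ ((n : ℚ) - (α : ℚ) / 2 + (β : ℚ) / ((α : ℚ) - 2)) * (α : ℚ) ^ k
        + ((α : ℚ) / 2) * (1 + (α : ℚ)) ^ k
        - ((β : ℚ) / ((α : ℚ) - 2)) * 2 ^ k := by
  have hα2 : (α : ℚ) - 2 ≠ 0 := by
    rw [sub_ne_zero]
    norm_cast
    rintro rfl
    exact absurd hα (by decide)
  have hβd : (β : ℚ) / ((α : ℚ) - 2) * ((α : ℚ) - 2) = β := div_mul_cancel₀ _ hα2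
  generalize (β : ℚ) / ((α : ℚ) - 2) = d at hβd ⊢
  induction k with
  | zero =>
    simp only [pow_zero, Finset.range_one, Finset.sum_singleton, add_zero, Function.iterate_zero,
      id, mul_one]
    linarith
  | succ k ih =>
    have hstep := two_mul_sum_collatz_iterate_succ_le hα hC n k
    generalize ∑ j ∈ Finset.range (2 ^ (k + 1)), C^[k + 1] (n + j) = t at hstep ⊢
    generalize ∑ j ∈ Finset.range (2 ^ k), C^[k] (n + j) = s at hstep ih
    have hstepQ : 2 * (t : ℚ) ≤ (1 + α) * s + α * (1 + α) ^ k + 2 ^ k * β := by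
      exact_mod_cast hstep
    have hα1 : (1 : ℚ) ≤ α := by exact_mod_cast hα0
    have hs : (1 + (α : ℚ)) * s ≤ 2 * α * s :=
      mul_le_mul_of_nonneg_right (by linarith) (Nat.cast_nonneg s)
    have hβ2 : (0 : ℚ) ≤ 2 ^ k * β := by positivity
    have hih := mul_le_mul_of_nonneg_left ih (Nat.cast_nonneg (α := ℚ) α)
    calc (t : ℚ) ≤ α * s + α / 2 * (1 + α) ^ k + 2 ^ k * β := by linarith
      _ ≤ α * ((n - α / 2 + d) * α ^ k + α / 2 * (1 + α) ^ k - d * 2 ^ k)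
          + α / 2 * (1 + α) ^ k + 2 ^ k * β := by linarith
      _ = _ := by
        rw [← hβd]
        ring
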